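/- arXiv:2107.10695 — 4 statements merged into one kernel-verified Lean document; each statement's English description precedes it below -/
import Mathlib

section
/- Fix m, k ∈ ℕ with m, k ≥ 1, p ∈ (0,1), and π ∈ (0,1/2). Then Σ_{s=0}^{k} C(k,s)·p^s·(1−p)^{k−s}·((1 + (1−2π)^s)/2)^m ≤ 2^{−m}·[ 1 + exp(−kpπ) + 2·exp( −(k/m)·H(p/2; p) ) ]^m. -/
open Finset

/-- Relative entropy (KL divergence) of Bernoulli(q) with respect to Bernoulli(p). -/
noncomputable def klBern (q p : ℝ) : ℝ :=
  q * Real.log (q / p) + (1 - q) * Real.log ((1 - q) / (1 - p))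

/-- The binomial probabilities with parameters `k` and `p` sum to one. -/
lemma sum_range_binomial_eq_one (k : ℕ) (p : ℝ) :
    ∑ s ∈ Finset.range (k + 1), (k.choose s : ℝ) * p ^ s * (1 - p) ^ (k - s) = 1 := by
  have h := add_pow p (1 - p) k
  rw [add_sub_cancel, one_pow] at h
  exact (Finset.sum_congr rfl fun s _ => by rw [mul_assoc, mul_comm]).trans h.symm

/-- Change of measure from Bernoulli(`p`) to Bernoulli(`q`) on outcomes with at most `k * q`
successes. -/
lemma pow_mul_pow_le_exp_klBern {p q : ℝ} (hq0 : 0 < q) (hqp : q ≤ p) (hp1 : p < 1)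
    {k s : ℕ} (hsk : s ≤ k) (hs : (s : ℝ) ≤ k * q) :
    p ^ s * (1 - p) ^ (k - s) ≤
      Real.exp (-(k * klBern q p)) * (q ^ s * (1 - q) ^ (k - s)) := by
  have hp0 : 0 < p := hq0.trans_le hqp
  have hp1' : 0 < 1 - p := sub_pos.2 hp1
  have hq1' : 0 < 1 - q := by linarith
  have hlog : Real.log q ≤ Real.log p := Real.log_le_log hq0 hqp
  have hlog' : Real.log (1 - p) ≤ Real.log (1 - q) := Real.log_le_log hp1' (by linarith)
  have hpow : ∀ {x : ℝ} (n : ℕ), 0 < x → x ^ n = Real.exp (n * Real.log x) := fun n hx => by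
    rw [Real.exp_nat_mul, Real.exp_log hx]
  rw [hpow s hp0, hpow s hq0, hpow (k - s) hp1', hpow (k - s) hq1', ← Real.exp_add,
    ← Real.exp_add, ← Real.exp_add, Real.exp_le_exp, klBern,
    Real.log_div hq0.ne' hp0.ne', Real.log_div hq1'.ne' hp1'.ne', Nat.cast_sub hsk]
  nlinarith [mul_nonneg (sub_nonneg.2 hs)
    (add_nonneg (sub_nonneg.2 hlog) (sub_nonneg.2 hlog'))]

/-- Chernoff bound for the lower tail of the binomial distribution. -/
lemma sum_binomial_lower_tail_le {p q : ℝ} (hq0 : 0 < q) (hqp : q ≤ p) (hp1 : p < 1) (k : ℕ) :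
    ∑ s ∈ Finset.range (k + 1) with ((s : ℕ) : ℝ) ≤ k * q,
        (k.choose s : ℝ) * p ^ s * (1 - p) ^ (k - s) ≤
      Real.exp (-(k * klBern q p)) := by
  have hq1 : 0 < 1 - q := by linarith
  calc
    _ ≤ ∑ s ∈ Finset.range (k + 1) with ((s : ℕ) : ℝ) ≤ k * q,
        Real.exp (-(k * klBern q p)) * ((k.choose s : ℝ) * q ^ s * (1 - q) ^ (k - s)) := by
      refine Finset.sum_le_sum fun s hs => ?_
      obtain ⟨hsk, hs⟩ := Finset.mem_filter.1 hs
      have h := mul_le_mul_of_nonneg_left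
        (pow_mul_pow_le_exp_klBern hq0 hqp hp1 (Finset.mem_range_succ_iff.1 hsk) hs)
        (Nat.cast_nonneg (α := ℝ) (k.choose s))
      linarith
    _ ≤ ∑ s ∈ Finset.range (k + 1),
        Real.exp (-(k * klBern q p)) * ((k.choose s : ℝ) * q ^ s * (1 - q) ^ (k - s)) :=
      Finset.sum_le_sum_of_subset_of_nonneg (Finset.filter_subset _ _)
        fun s _ _ => by positivity
    _ = Real.exp (-(k * klBern q p)) := by
      rw [← Finset.mul_sum, sum_range_binomial_eq_one, mul_one]

/-- first kernel-probability upper bound of Lemma on submatrix kernels. -/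
theorem stmt_11 (m k : ℕ) (hm : 1 ≤ m) (hk : 1 ≤ k) (p π : ℝ)
    (hp0 : 0 < p) (hp1 : p < 1) (hπ0 : 0 < π) (hπ2 : π < 1 / 2) :
    ∑ s ∈ Finset.range (k + 1),
        (k.choose s : ℝ) * p ^ s * (1 - p) ^ (k - s) * ((1 + (1 - 2 * π) ^ s) / 2) ^ m ≤
      ((2 : ℝ) ^ m)⁻¹ *
        (1 + Real.exp (-((k : ℝ) * p * π)) +
          2 * Real.exp (-((k : ℝ) / (m : ℝ)) * klBern (p / 2) p)) ^ m := by
  set A : ℝ := 1 + Real.exp (-((k : ℝ) * p * π)) with hA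
  set B : ℝ := 2 * Real.exp (-((k : ℝ) / (m : ℝ)) * klBern (p / 2) p) with hB
  have hA0 : 0 ≤ A := by positivity
  have hB0 : 0 ≤ B := by positivity
  have hp1' : 0 < 1 - p := sub_pos.2 hp1
  have hx0 : 0 < 1 - 2 * π := by linarith
  have hBpow : (2 : ℝ) ^ m * Real.exp (-(k * klBern (p / 2) p)) = B ^ m := by
    have hm0 : (m : ℝ) ≠ 0 := by exact_mod_cast (by omega : m ≠ 0)
    rw [hB, mul_pow, ← Real.exp_nat_mul]
    congr 2
    field_simp
  have hlow : ∀ s : ℕ, (1 + (1 - 2 * π) ^ s) ^ m ≤ 2 ^ m := fun s => by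
    gcongr
    linarith [pow_le_one₀ (n := s) hx0.le (by linarith)]
  have hhigh : ∀ s : ℕ, (k : ℝ) * (p / 2) ≤ s → (1 + (1 - 2 * π) ^ s) ^ m ≤ A ^ m := by
    intro s hs
    have h : (1 - 2 * π) ^ s ≤ Real.exp (-((k : ℝ) * p * π)) :=
      calc (1 - 2 * π) ^ s ≤ Real.exp (-(2 * π)) ^ s := by
            gcongr
            exact Real.one_sub_le_exp_neg _
        _ = Real.exp (s * -(2 * π)) := (Real.exp_nat_mul _ _).symm
        _ ≤ _ := Real.exp_le_exp.2 (by nlinarith)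
    rw [hA]
    gcongr
  set w : ℕ → ℝ := fun s => (k.choose s : ℝ) * p ^ s * (1 - p) ^ (k - s) with hw
  have hw0 : ∀ s, 0 ≤ w s := fun s => by positivity
  have key : ∑ s ∈ Finset.range (k + 1), w s * (1 + (1 - 2 * π) ^ s) ^ m ≤ (A + B) ^ m := by
    calc
      _ ≤ ∑ s ∈ Finset.range (k + 1),
          (w s * A ^ m + if (s : ℝ) ≤ k * (p / 2) then w s * 2 ^ m else 0) := by
        refine Finset.sum_le_sum fun s _ => ?_
        split_ifs with hs
        · exact (mul_le_mul_of_nonneg_left (hlow s) (hw0 s)).trans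
            (le_add_of_nonneg_left (mul_nonneg (hw0 s) (pow_nonneg hA0 m)))
        · rw [add_zero]
          exact mul_le_mul_of_nonneg_left (hhigh s (not_le.1 hs).le) (hw0 s)
      _ = A ^ m + 2 ^ m * ∑ s ∈ Finset.range (k + 1) with ((s : ℕ) : ℝ) ≤ k * (p / 2), w s := by
        rw [Finset.sum_add_distrib, ← Finset.sum_filter, ← Finset.sum_mul, ← Finset.sum_mul,
          sum_range_binomial_eq_one, one_mul, mul_comm (2 ^ m : ℝ)]
      _ ≤ A ^ m + B ^ m := by
        rw [← hBpow]
        gcongr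
        exact sum_binomial_lower_tail_le (half_pos hp0) (half_le_self hp0.le) hp1 k
      _ ≤ (A + B) ^ m := pow_add_pow_le hA0 hB0 (by omega)
  calc
    _ = ((2 : ℝ) ^ m)⁻¹ * ∑ s ∈ Finset.range (k + 1), w s * (1 + (1 - 2 * π) ^ s) ^ m := by
      rw [Finset.mul_sum]
      refine Finset.sum_congr rfl fun s _ => ?_
      rw [hw, div_pow, div_eq_mul_inv]
      ring
    _ ≤ _ := by gcongr
end

section
/- Fix m, k ∈ ℕ with m, k ≥ 1, p ∈ (0,1), and π ∈ (0,1/2). Suppose that (1−2π)^k ≥ 1/2 and (1 − πk/2)^m ≥ 1/2. Then Σ_{s=0}^{k} C(k,s)·p^s·(1−p)^{k−s}·((1 + (1−2π)^s)/2)^m ≤ exp(−k·m·p·π/4). -/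
open Finset

/-- A power of `1 - a` is bounded by an exponential: `(1 - a) ^ n ≤ exp (-(n * a))`. -/
lemma one_sub_pow_le_exp_neg_mul {a : ℝ} (ha : a ≤ 1) (n : ℕ) :
    (1 - a) ^ n ≤ Real.exp (-(n * a)) := by
  calc (1 - a) ^ n ≤ Real.exp (-a) ^ n :=
        pow_le_pow_left₀ (by linarith) (Real.one_sub_le_exp_neg a) n
    _ = Real.exp (-(n * a)) := by rw [← Real.exp_nat_mul, mul_neg]

lemma exp_neg_le_inv_one_add {x : ℝ} (hx : -1 < x) : Real.exp (-x) ≤ (1 + x)⁻¹ := by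
  rw [Real.exp_neg]
  exact inv_anti₀ (by linarith) (by linarith [Real.add_one_le_exp x])

lemma exp_neg_le_one_sub_half {x : ℝ} (hx0 : 0 ≤ x) (hx1 : x ≤ 1) :
    Real.exp (-x) ≤ 1 - x / 2 := by
  refine (exp_neg_le_inv_one_add (by linarith)).trans ?_
  rw [inv_le_iff_one_le_mul₀ (by linarith)]
  nlinarith [mul_nonneg hx0 (sub_nonneg.mpr hx1)]

lemma mul_le_one_of_half_le_one_sub_pow {a : ℝ} {n : ℕ} (ha0 : 0 ≤ a) (ha1 : a ≤ 1)
    (h : 1 / 2 ≤ (1 - a) ^ n) : n * a ≤ 1 := by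
  have hna : 0 ≤ n * a := by positivity
  have hinv := h.trans ((one_sub_pow_le_exp_neg_mul ha1 n).trans
    (exp_neg_le_inv_one_add (by linarith)))
  rw [le_inv_comm₀ (by norm_num) (by linarith)] at hinv
  norm_num at hinv
  linarith

lemma one_sub_pow_le_one_sub_half_mul {a : ℝ} {n : ℕ} (ha0 : 0 ≤ a) (ha1 : a ≤ 1)
    (h : n * a ≤ 1) : (1 - a) ^ n ≤ 1 - n * a / 2 :=
  (one_sub_pow_le_exp_neg_mul ha1 n).trans (exp_neg_le_one_sub_half (by positivity) h)

lemma sum_choose_mul_pow_mul_pow_one_sub (k : ℕ) (p : ℝ) :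
    ∑ s ∈ range (k + 1), (k.choose s : ℝ) * p ^ s * (1 - p) ^ (k - s) = 1 := by
  simpa [Polynomial.eval_finsetSum, bernsteinPolynomial] using
    congrArg (Polynomial.eval p) (bernsteinPolynomial.sum ℝ k)

/-- The mean of the binomial distribution with parameters `k` and `p` is `k * p`. -/
lemma sum_choose_mul_pow_mul_pow_one_sub_mul (k : ℕ) (p : ℝ) :
    ∑ s ∈ range (k + 1), (k.choose s : ℝ) * p ^ s * (1 - p) ^ (k - s) * s = k * p := by
  simpa [Polynomial.eval_finsetSum, bernsteinPolynomial, mul_comm, mul_left_comm, mul_assoc] using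
    congrArg (Polynomial.eval p) (bernsteinPolynomial.sum_smul ℝ k)

/-- small-`k` kernel-probability upper bound of Lemma on submatrix kernels. -/
theorem stmt_12 (m k : ℕ) (hm : 1 ≤ m) (hk : 1 ≤ k) (p π : ℝ)
    (hp0 : 0 < p) (hp1 : p < 1) (hπ0 : 0 < π) (hπ2 : π < 1 / 2)
    (h1 : (1 / 2 : ℝ) ≤ (1 - 2 * π) ^ k)
    (h2 : (1 / 2 : ℝ) ≤ (1 - π * k / 2) ^ m) :
    ∑ s ∈ Finset.range (k + 1),
        (k.choose s : ℝ) * p ^ s * (1 - p) ^ (k - s) * ((1 + (1 - 2 * π) ^ s) / 2) ^ m ≤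
      Real.exp (-((k : ℝ) * m * p * π) / 4) := by
  have hk1 : k * (2 * π) ≤ 1 :=
    mul_le_one_of_half_le_one_sub_pow (by linarith) (by linarith) h1
  have hm1 : m * (π * k / 2) ≤ 1 :=
    mul_le_one_of_half_le_one_sub_pow (by positivity) (by linarith) h2
  have hterm : ∀ s ∈ range (k + 1),
      ((1 + (1 - 2 * π) ^ s) / 2) ^ m ≤ 1 - m * π / 4 * s := by
    intro s hs
    have hsk : (s : ℝ) ≤ k := by exact_mod_cast Nat.lt_succ_iff.mp (mem_range.mp hs)
    have hπs : π * s ≤ π * k := mul_le_mul_of_nonneg_left hsk hπ0.le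
    have hbase : (1 - 2 * π) ^ s ≤ 1 - s * (2 * π) / 2 :=
      one_sub_pow_le_one_sub_half_mul (by linarith) (by linarith) (by linarith)
    have hnonneg : 0 ≤ (1 - 2 * π) ^ s := pow_nonneg (by linarith) s
    calc ((1 + (1 - 2 * π) ^ s) / 2) ^ m ≤ (1 - π * s / 2) ^ m :=
          pow_le_pow_left₀ (by linarith) (by linarith) m
      _ ≤ 1 - m * (π * s / 2) / 2 :=
          one_sub_pow_le_one_sub_half_mul (by positivity) (by linarith)
            (le_trans (by gcongr) hm1)
      _ = 1 - m * π / 4 * s := by ring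
  calc ∑ s ∈ range (k + 1),
        (k.choose s : ℝ) * p ^ s * (1 - p) ^ (k - s) * ((1 + (1 - 2 * π) ^ s) / 2) ^ m
      ≤ ∑ s ∈ range (k + 1),
        (k.choose s : ℝ) * p ^ s * (1 - p) ^ (k - s) * (1 - m * π / 4 * s) := by
        refine sum_le_sum fun s hs => mul_le_mul_of_nonneg_left (hterm s hs) ?_
        have := sub_pos.mpr hp1
        positivity
    _ = ∑ s ∈ range (k + 1), (k.choose s : ℝ) * p ^ s * (1 - p) ^ (k - s) - m * π / 4 *
        ∑ s ∈ range (k + 1), (k.choose s : ℝ) * p ^ s * (1 - p) ^ (k - s) * s := by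
        rw [mul_sum, ← sum_sub_distrib]
        exact sum_congr rfl fun s _ => by ring
    _ = 1 - k * m * p * π / 4 := by
        rw [sum_choose_mul_pow_mul_pow_one_sub, sum_choose_mul_pow_mul_pow_one_sub_mul]
        ring
    _ ≤ Real.exp (-((k : ℝ) * m * p * π) / 4) := by
        rw [neg_div]
        exact Real.one_sub_le_exp_neg _
end

section
/- Let x ∈ (0, 1/2) and let s ≥ 0 be a real number such that (1−2x)^s ≥ 1/2. Then (1−2x)^s ≤ 1 − x·s. -/
/-- for `x ∈ (0,1/2)` and real `s ≥ 0` with `(1−2x)^s ≥ 1/2`, one has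
`(1−2x)^s ≤ 1 − x·s` (real powers). -/
theorem stmt_13 (x s : ℝ) (hx0 : 0 < x) (hx2 : x < 1 / 2) (hs : 0 ≤ s)
    (h : (1 / 2 : ℝ) ≤ (1 - 2 * x) ^ s) :
    (1 - 2 * x) ^ s ≤ 1 - x * s := by
  have hb : 0 < 1 - 2 * x := by linarith
  have hu1 : (1 - 2 * x) ^ s ≤ 1 := Real.rpow_le_one hb.le (by linarith) hs
  have hlog : Real.log ((1 - 2 * x) ^ s) = s * Real.log (1 - 2 * x) := Real.log_rpow hb s
  have hupper : s * Real.log (1 - 2 * x) ≤ s * (1 - 2 * x - 1) :=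
    mul_le_mul_of_nonneg_left (Real.log_le_sub_one_of_pos hb) hs
  generalize (1 - 2 * x) ^ s = u at *
  have hu : 0 < u := by linarith
  have hlower : 1 - u⁻¹ ≤ Real.log u := Real.one_sub_inv_le_log_of_pos hu
  have hinv : 2 * (u - 1) ≤ 1 - u⁻¹ := by
    have hfactor : 1 - u⁻¹ - 2 * (u - 1) = (1 - u) * (2 * u - 1) / u := by
      field_simp
      ring
    have : 0 ≤ (1 - u) * (2 * u - 1) / u :=
      div_nonneg (mul_nonneg (by linarith) (by linarith)) hu.le
    linarith
  linarith
end

section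
/- Fix p ∈ (0,1), δ ∈ (0,1), β > 8, and set γ = 1 + β/8 and t = ⌈1/p⌉ + 1. Let α > 0 be small enough that (1 − αβ/(2p(1−δ)))^t > 1/2 and exp(−αβ/(2(1−δ))) > 1/2. For n ∈ ℕ define π_n = β·log((1−δ)np)/((1−δ)np). Then there exists N such that for all n ≥ N and all integers k with 1 ≤ k ≤ αn/log(n): [ Σ_{s=0}^{k} C(k,s)·p^s·(1−p)^{k−s}·((1 + (1−2π_n)^s)/2)^t ]^{(1−δ)np} ≤ n^{−γk}. -/
open Finset

/-- A reverse Bernoulli inequality, valid as long as `2 * q * j` stays at most `1`. -/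
theorem one_sub_two_mul_pow_le {q : ℝ} {t : ℕ} (hq : 0 ≤ q) (hqt : 2 * q * t ≤ 1) :
    ∀ j ≤ t, (1 - 2 * q) ^ j ≤ 1 - q * j := by
  intro j
  induction j with
  | zero => simp
  | succ j ih =>
    intro hj
    have h := ih (by omega)
    have hjt : (j : ℝ) + 1 ≤ t := by exact_mod_cast hj
    have hqj : 2 * q * (j + 1) ≤ 1 := (mul_le_mul_of_nonneg_left hjt (by positivity)).trans hqt
    have hj0 : (0 : ℝ) ≤ j := j.cast_nonneg
    have hqj0 : 0 ≤ q * j := by positivity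
    have hx : 0 ≤ 1 - 2 * q := by linarith
    rw [pow_succ]
    push_cast
    calc (1 - 2 * q) ^ j * (1 - 2 * q) ≤ (1 - q * j) * (1 - 2 * q) := by gcongr
      _ ≤ 1 - q * (j + 1) := by nlinarith

/-- Expanding the `t`-th power and exchanging the sums in a binomial expectation. -/
theorem sum_binomial_mul_half_one_add_pow (p x : ℝ) (k t : ℕ) :
    ∑ s ∈ range (k + 1), (k.choose s : ℝ) * p ^ s * (1 - p) ^ (k - s) * ((1 + x ^ s) / 2) ^ t =
      ∑ j ∈ range (t + 1), (t.choose j : ℝ) / 2 ^ t * (p * x ^ j + (1 - p)) ^ k := by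
  have h (s : ℕ) : ((1 + x ^ s) / 2) ^ t =
      ∑ j ∈ range (t + 1), (t.choose j : ℝ) / 2 ^ t * (x ^ j) ^ s := by
    rw [div_pow, add_comm, add_pow, sum_div]
    refine sum_congr rfl fun j _ => ?_
    rw [one_pow, ← pow_mul, ← pow_mul, mul_comm s j]
    ring
  simp_rw [h, add_pow, mul_sum]
  rw [sum_comm]
  refine sum_congr rfl fun j _ => sum_congr rfl fun s _ => ?_
  rw [mul_pow]
  ring

theorem sum_binomial_mul_half_one_add_pow_le {p q : ℝ} {k t : ℕ} (hp0 : 0 ≤ p) (hp1 : p ≤ 1)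
    (hq : 0 ≤ q) (hqt : 2 * q * t ≤ 1) :
    ∑ s ∈ range (k + 1), (k.choose s : ℝ) * p ^ s * (1 - p) ^ (k - s) *
        ((1 + (1 - 2 * q) ^ s) / 2) ^ t ≤
      ((1 + Real.exp (-(p * q * k))) / 2) ^ t := by
  rw [sum_binomial_mul_half_one_add_pow, div_pow, add_comm 1, add_pow, sum_div]
  refine sum_le_sum fun j hj => ?_
  have hjt : j ≤ t := by simpa [Nat.lt_succ_iff] using hj
  rcases Nat.eq_zero_or_pos j with rfl | hj0
  · simp
  have hqq : 2 * q ≤ 1 := by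
    have : (1 : ℝ) ≤ t := by exact_mod_cast hj0.trans_le hjt
    nlinarith
  have hx : 0 ≤ (1 - 2 * q) ^ j := pow_nonneg (by linarith) j
  have hbase : p * (1 - 2 * q) ^ j + (1 - p) ≤ Real.exp (-(p * q * j)) := by
    have h1 := mul_le_mul_of_nonneg_left (one_sub_two_mul_pow_le hq hqt j hjt) hp0
    have h2 := Real.add_one_le_exp (-(p * q * j))
    linarith
  have hpow : (p * (1 - 2 * q) ^ j + (1 - p)) ^ k ≤ Real.exp (-(p * q * k)) ^ j := by
    calc (p * (1 - 2 * q) ^ j + (1 - p)) ^ k ≤ Real.exp (-(p * q * j)) ^ k :=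
          pow_le_pow_left₀ (add_nonneg (mul_nonneg hp0 hx) (by linarith)) hbase k
      _ = Real.exp (-(p * q * k)) ^ j := by
          rw [← Real.exp_nat_mul, ← Real.exp_nat_mul]
          ring_nf
  calc (t.choose j : ℝ) / 2 ^ t * (p * (1 - 2 * q) ^ j + (1 - p)) ^ k
      ≤ (t.choose j : ℝ) / 2 ^ t * Real.exp (-(p * q * k)) ^ j := by gcongr
    _ = _ := by
      rw [one_pow]
      ring

theorem half_one_add_exp_neg_le {y : ℝ} (hy0 : 0 ≤ y) (hy : 1 / 2 ≤ Real.exp (-(y / 2))) :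
    (1 + Real.exp (-y)) / 2 ≤ Real.exp (-(y / 4)) := by
  have h2 : Real.exp (-(y / 2)) = Real.exp (-(y / 4)) ^ 2 := by
    rw [← Real.exp_nat_mul]
    ring_nf
  have h4 : Real.exp (-y) = Real.exp (-(y / 4)) ^ 4 := by
    rw [← Real.exp_nat_mul]
    ring_nf
  have hw1 : Real.exp (-(y / 4)) ≤ 1 := Real.exp_le_one_iff.2 (by linarith)
  have hw0 := Real.exp_pos (-(y / 4))
  rw [h2] at hy
  rw [h4]
  generalize Real.exp (-(y / 4)) = w at *
  have hfac : 0 ≤ (1 - w) * (w ^ 3 + w ^ 2 + w - 1) :=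
    mul_nonneg (by linarith) (by nlinarith [pow_pos hw0 3])
  linarith [show (1 - w) * (w ^ 3 + w ^ 2 + w - 1) = 2 * w - 1 - w ^ 4 by ring]

/-- The binomial expectation decays like `exp (-(q * k) / 4)` once `t * p ≥ 1`. -/
theorem sum_binomial_le_exp {p q : ℝ} {k t : ℕ} (hp0 : 0 ≤ p) (hp1 : p ≤ 1)
    (hq : 0 ≤ q) (hqt : 2 * q * t ≤ 1) (htp : 1 ≤ t * p)
    (hy : 1 / 2 ≤ Real.exp (-(p * q * k / 2))) :
    ∑ s ∈ range (k + 1), (k.choose s : ℝ) * p ^ s * (1 - p) ^ (k - s) *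
        ((1 + (1 - 2 * q) ^ s) / 2) ^ t ≤ Real.exp (-(q * k / 4)) := by
  refine (sum_binomial_mul_half_one_add_pow_le hp0 hp1 hq hqt).trans ?_
  calc ((1 + Real.exp (-(p * q * k))) / 2) ^ t ≤ Real.exp (-(p * q * k / 4)) ^ t := by
        gcongr
        exact half_one_add_exp_neg_le (by positivity) hy
    _ = Real.exp (-(t * p * (q * k / 4))) := by
        rw [← Real.exp_nat_mul]
        ring_nf
    _ ≤ Real.exp (-(q * k / 4)) := by
        gcongr
        exact le_mul_of_one_le_left (by positivity) htp

open Filter Topology in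
theorem eventually_log_conditions {c β C : ℝ} (hc : 0 < c) (hβ : 8 < β) :
    ∀ᶠ n : ℕ in atTop, 1 < n ∧ 1 < c * n ∧
      2 * (β * Real.log (c * n) / (c * n)) * C ≤ 1 ∧
      (1 + β / 8) * Real.log n ≤ β * Real.log (c * n) / 4 := by
  have hcn : Tendsto (fun n : ℕ => c * (n : ℝ)) atTop atTop :=
    tendsto_natCast_atTop_atTop.const_mul_atTop hc
  have hlog : Tendsto (fun n : ℕ => Real.log n) atTop atTop :=
    Real.tendsto_log_atTop.comp tendsto_natCast_atTop_atTop
  have hdiv : Tendsto (fun x : ℝ => Real.log x / x) atTop (𝓝 0) := by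
    simpa using Real.tendsto_pow_log_div_mul_add_atTop 1 0 1 one_ne_zero
  have hsmall : Tendsto (fun n : ℕ => 2 * (β * Real.log (c * n) / (c * n)) * C) atTop (𝓝 0) := by
    have h := (hdiv.comp hcn).const_mul (2 * β * C)
    rw [mul_zero] at h
    refine h.congr fun n => ?_
    simp only [Function.comp_apply]
    ring
  filter_upwards [eventually_gt_atTop 1, hcn.eventually_gt_atTop 1,
    hsmall.eventually_le_const zero_lt_one,
    hlog.eventually_ge_atTop (-(β * Real.log c / 4) / (β / 8 - 1))] with n hn1 hn2 hn3 hn4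
  refine ⟨hn1, hn2, hn3, ?_⟩
  have hn0 : (n : ℝ) ≠ 0 := by positivity
  rw [Real.log_mul hc.ne' hn0]
  rw [div_le_iff₀ (by linarith)] at hn4
  linarith

/-- small-`k` kernel bound for Algorithm RLNC(β).  With `t = ⌈1/p⌉+1`,
`γ = 1+β/8` and `π_n = β log((1−δ)np)/((1−δ)np)`, for all large `n` and all
`1 ≤ k ≤ αn/log n`, the kernel probability raised to the power `(1−δ)np` is at most
`n^{−γk}`. -/
theorem stmt_14 (p δ β α : ℝ) (hp0 : 0 < p) (hp1 : p < 1) (hδ0 : 0 < δ) (hδ1 : δ < 1)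
    (hβ : 8 < β) (hα0 : 0 < α)
    (hα1 : (1 / 2 : ℝ) < (1 - α * β / (2 * p * (1 - δ))) ^ (⌈1 / p⌉₊ + 1))
    (hα2 : (1 / 2 : ℝ) < Real.exp (-(α * β) / (2 * (1 - δ)))) :
    ∃ N : ℕ, ∀ n : ℕ, N ≤ n → ∀ k : ℕ, 1 ≤ k → (k : ℝ) ≤ α * n / Real.log n →
      (∑ s ∈ Finset.range (k + 1),
          (k.choose s : ℝ) * p ^ s * (1 - p) ^ (k - s) *
            ((1 + (1 - 2 * (β * Real.log ((1 - δ) * n * p) / ((1 - δ) * n * p))) ^ s) / 2) ^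
              (⌈1 / p⌉₊ + 1)) ^ ((1 - δ) * n * p) ≤
        (n : ℝ) ^ (-((1 + β / 8) * k)) := by
  have hc : 0 < (1 - δ) * p := mul_pos (by linarith) hp0
  obtain ⟨N, hN⟩ := Filter.eventually_atTop.1
    (eventually_log_conditions (C := ((⌈1 / p⌉₊ + 1 : ℕ) : ℝ)) hc hβ)
  refine ⟨N, fun n hn k _ hk => ?_⟩
  obtain ⟨hn1, hM1, hqt, hlog⟩ := hN n hn
  rw [show (1 - δ) * p * (n : ℝ) = (1 - δ) * n * p by ring] at hM1 hqt hlog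
  have hn0 : (0 : ℝ) < n := by positivity
  have hlogn : 0 < Real.log n := Real.log_pos (by exact_mod_cast hn1)
  have hL : 0 < Real.log ((1 - δ) * n * p) := Real.log_pos hM1
  have hLn : Real.log ((1 - δ) * n * p) ≤ Real.log n :=
    Real.log_le_log (by linarith) (by nlinarith [mul_pos hδ0 hp0])
  have hδ : 0 < 1 - δ := by linarith
  have hq : 0 ≤ β * Real.log ((1 - δ) * n * p) / ((1 - δ) * n * p) := by positivity
  have htp : 1 ≤ ((⌈1 / p⌉₊ + 1 : ℕ) : ℝ) * p := by
    have h := (div_le_iff₀ hp0).1 (Nat.le_ceil (1 / p))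
    push_cast
    linarith
  have hy : p * (β * Real.log ((1 - δ) * n * p) / ((1 - δ) * n * p)) * k ≤
      α * β / (1 - δ) := by
    calc p * (β * Real.log ((1 - δ) * n * p) / ((1 - δ) * n * p)) * k
        ≤ p * (β * Real.log n / ((1 - δ) * n * p)) * (α * n / Real.log n) := by gcongr
      _ = α * β / (1 - δ) := by field_simp
  have hexp : 1 / 2 ≤
      Real.exp (-(p * (β * Real.log ((1 - δ) * n * p) / ((1 - δ) * n * p)) * k / 2)) := by
    refine hα2.le.trans (Real.exp_le_exp.2 ?_)
    rw [show -(α * β) / (2 * (1 - δ)) = -(α * β / (1 - δ) / 2) by field_simp]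
    linarith
  have hS := sum_binomial_le_exp hp0.le hp1.le hq hqt htp hexp
  refine (Real.rpow_le_rpow ?_ hS (by linarith)).trans ?_
  · have hq1 : 2 * (β * Real.log ((1 - δ) * n * p) / ((1 - δ) * n * p)) ≤ 1 := by
      refine (le_mul_of_one_le_right (by positivity) ?_).trans hqt
      exact_mod_cast Nat.le_add_left 1 _
    have h1p : 0 ≤ 1 - p := by linarith
    refine sum_nonneg fun s _ => ?_
    have := pow_nonneg (sub_nonneg.2 hq1) s
    positivity
  rw [← Real.exp_mul, Real.rpow_def_of_pos hn0, Real.exp_le_exp]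
  have hM : -(β * Real.log ((1 - δ) * n * p) / ((1 - δ) * n * p) * k / 4) * ((1 - δ) * n * p) =
      -(β * Real.log ((1 - δ) * n * p) / 4 * k) := by
    generalize Real.log ((1 - δ) * n * p) = L
    field_simp
  rw [hM]
  have := mul_le_mul_of_nonneg_right hlog k.cast_nonneg
  linarith
end
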